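/- Let $K$ be a field of characteristic zero, let $\Sigma \subseteq \mathrm{GL}_n(K)$ be a subset admitting a purely exponential parametrization (viewed inside $K^{n^2}$ via matrix entries), and let $s \in \mathrm{GL}_n(K)$ be a semi-simple matrix. Then the product set $\Sigma \cdot \langle s \rangle = \{\sigma s^k : \sigma \in \Sigma, k \in \mathbb{Z}\}$ also admits a purely exponential parametrization. -/

import Mathlib

open scoped BigOperators nonZeroDivisors

noncomputable section

namespace PEP

/-- A purely exponential polynomial in `r` variables with prescribed bases `lam`. -/
def IsPEPolyWith (K : Type*) [Field K] {k r : ℕ}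
    (lam : Fin k → (AlgebraicClosure K)ˣ) (f : (Fin r → ℤ) → AlgebraicClosure K) : Prop :=
  ∃ (e : ℕ) (a : Fin e → (AlgebraicClosure K)ˣ)
    (l : Fin k → Fin e → ((Fin r → ℤ) →+ ℤ)),
    ∀ n : Fin r → ℤ,
      f n = ∑ j : Fin e, (a j : AlgebraicClosure K) *
        ∏ i : Fin k, ((lam i ^ (l i j n) : (AlgebraicClosure K)ˣ) : AlgebraicClosure K)

/-- A purely exponential polynomial in `r` variables over a field `K`. -/
def IsPEPoly (K : Type*) [Field K] {r : ℕ} (f : (Fin r → ℤ) → AlgebraicClosure K) : Prop :=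
  ∃ (k : ℕ) (lam : Fin k → (AlgebraicClosure K)ˣ), IsPEPolyWith K lam f

/-- A subset of `K^ι` admitting a purely exponential parametrization in `r` variables. -/
def IsPEPSet (K : Type*) [Field K] {ι : Type*} [Fintype ι] (r : ℕ)
    (S : Set (ι → K)) : Prop :=
  ∃ f : ι → ((Fin r → ℤ) → AlgebraicClosure K),
    (∀ i, IsPEPoly K (f i)) ∧
    (∀ m : Fin r → ℤ, ∃ x ∈ S, ∀ i, algebraMap K (AlgebraicClosure K) (x i) = f i m) ∧
    (∀ x ∈ S, ∃ m : Fin r → ℤ, ∀ i, algebraMap K (AlgebraicClosure K) (x i) = f i m)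

/-- The sup-norm of an integer vector. -/
def zNorm {r : ℕ} (n : Fin r → ℤ) : ℕ := Finset.univ.sup fun i => (n i).natAbs

open NumberField

/-- The "denominator" fractional ideal generated by `1` and the coordinates of `x`. -/
def denomIdeal {K : Type*} [Field K] [NumberField K] {ι : Type*} [Fintype ι]
    (x : ι → K) : FractionalIdeal (𝓞 K)⁰ K :=
  1 + ∑ i : ι, FractionalIdeal.spanSingleton (𝓞 K)⁰ (x i)

/-- The affine multiplicative (Weil) height of a tuple of elements of a number field,
normalized so as to be independent of the field. -/
def mulHeight {K : Type*} [Field K] [NumberField K] {ι : Type*} [Fintype ι]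
    (x : ι → K) : ℝ :=
  ((∏ w : InfinitePlace K, max 1 (⨆ i : ι, w (x i)) ^ w.mult) *
      (((FractionalIdeal.absNorm (denomIdeal x) : ℚ) : ℝ))⁻¹) ^
    ((Module.finrank ℚ K : ℝ)⁻¹)

/-- The logarithmic affine height of a tuple. -/
def logHeight {K : Type*} [Field K] [NumberField K] {ι : Type*} [Fintype ι]
    (x : ι → K) : ℝ :=
  Real.log (mulHeight x)

/-- The logarithmic height of a single element of a number field. -/
def logHeight₁ {K : Type*} [Field K] [NumberField K] (x : K) : ℝ :=
  logHeight (fun _ : Fin 1 => x)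

/-- A matrix over `K` is semi-simple if it is diagonalizable over an algebraic closure. -/
def IsSemisimpleMat {K : Type*} [Field K] {n : ℕ} (A : Matrix (Fin n) (Fin n) K) : Prop :=
  ∃ (P : (Matrix (Fin n) (Fin n) (AlgebraicClosure K))ˣ) (d : Fin n → AlgebraicClosure K),
    (↑P⁻¹ : Matrix (Fin n) (Fin n) (AlgebraicClosure K)) *
      A.map (algebraMap K (AlgebraicClosure K)) * (P : Matrix (Fin n) (Fin n) (AlgebraicClosure K)) =
      Matrix.diagonal d

/-- The tuple of entries of a matrix, as a point of affine `n²`-space. -/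
def entries {K : Type*} [Field K] {n : ℕ} (A : Matrix (Fin n) (Fin n) K) :
    (Fin n × Fin n) → K := fun p => A p.1 p.2

end PEP

namespace PEP

variable {K : Type*} [Field K] {r : ℕ}

/-- Linear combinations of characters of `ℤ^r` are purely exponential polynomials. -/
theorem isPEPoly_of_eq_sum_characters {ι : Type} [Fintype ι]
    {f : (Fin r → ℤ) → AlgebraicClosure K} (a : ι → (AlgebraicClosure K)ˣ)
    (χ : ι → Multiplicative (Fin r → ℤ) →* (AlgebraicClosure K)ˣ)
    (h : ∀ n, f n = ∑ j, (a j : AlgebraicClosure K) * (χ j (.ofAdd n) : AlgebraicClosure K)) :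
    IsPEPoly K f := by
  classical
  let E := Fintype.equivFin ι
  let F := Fintype.equivFin (ι × Fin r)
  refine ⟨_, fun i => χ (F.symm i).1 (.ofAdd (Pi.single (F.symm i).2 1)), _,
    fun j => a (E.symm j),
    fun i j => if (F.symm i).1 = E.symm j then Pi.evalAddMonoidHom _ (F.symm i).2 else 0, ?_⟩
  intro n
  rw [h n, ← E.symm.sum_comp]
  refine Finset.sum_congr rfl fun j _ => ?_
  congr 1
  rw [← Units.coe_prod]
  congr 1
  rw [F.symm.prod_comp (fun p : ι × Fin r => χ p.1 (.ofAdd (Pi.single p.2 1)) ^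
    ((if p.1 = E.symm j then Pi.evalAddMonoidHom (fun _ : Fin r => ℤ) p.2 else 0) n)),
    Fintype.prod_prod_type, Finset.prod_eq_single (E.symm j)]
  · have hn : Multiplicative.ofAdd n =
        ∏ m : Fin r, Multiplicative.ofAdd (Pi.single m (1 : ℤ) : Fin r → ℤ) ^ n m := by
      apply Multiplicative.toAdd.injective
      rw [toAdd_prod]
      ext t
      simp [Finset.sum_apply, Pi.single_apply]
    rw [hn, map_prod]
    simp
  · intro b _ hb
    simp [hb]
  · simp

/-- Every purely exponential polynomial is a linear combination of characters of `ℤ^r`. -/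
theorem IsPEPoly.exists_eq_sum_characters {f : (Fin r → ℤ) → AlgebraicClosure K}
    (hf : IsPEPoly K f) :
    ∃ (e : ℕ) (a : Fin e → (AlgebraicClosure K)ˣ)
      (χ : Fin e → Multiplicative (Fin r → ℤ) →* (AlgebraicClosure K)ˣ),
      ∀ n, f n = ∑ j, (a j : AlgebraicClosure K) * (χ j (.ofAdd n) : AlgebraicClosure K) := by
  obtain ⟨k, lam, e, a, l, h⟩ := hf
  refine ⟨e, a, fun j => ∏ i, (zpowersHom _ (lam i)).comp (l i j).toMultiplicative, fun n => ?_⟩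
  simp [h n, MonoidHom.finsetProd_apply]

theorem isPEPoly_const (c : AlgebraicClosure K) :
    IsPEPoly K (fun _ : Fin r → ℤ => c) := by
  by_cases hc : c = 0
  · exact isPEPoly_of_eq_sum_characters (ι := Empty) Empty.elim Empty.elim (by simp [hc])
  · exact isPEPoly_of_eq_sum_characters (ι := Unit) (fun _ => Units.mk0 c hc) (fun _ => 1) (by simp)

theorem isPEPoly_zpow (u : (AlgebraicClosure K)ˣ) (φ : (Fin r → ℤ) →+ ℤ) :
    IsPEPoly K (fun n => ((u ^ φ n : (AlgebraicClosure K)ˣ) : AlgebraicClosure K)) :=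
  isPEPoly_of_eq_sum_characters (ι := Unit) (fun _ => 1)
    (fun _ => (zpowersHom _ u).comp φ.toMultiplicative) (by simp)

theorem IsPEPoly.add {f g : (Fin r → ℤ) → AlgebraicClosure K}
    (hf : IsPEPoly K f) (hg : IsPEPoly K g) : IsPEPoly K (fun n => f n + g n) := by
  obtain ⟨e, a, χ, h⟩ := hf.exists_eq_sum_characters
  obtain ⟨e', a', χ', h'⟩ := hg.exists_eq_sum_characters
  exact isPEPoly_of_eq_sum_characters (Sum.elim a a') (Sum.elim χ χ') (by simp [h, h'])

theorem IsPEPoly.mul {f g : (Fin r → ℤ) → AlgebraicClosure K}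
    (hf : IsPEPoly K f) (hg : IsPEPoly K g) : IsPEPoly K (fun n => f n * g n) := by
  obtain ⟨e, a, χ, h⟩ := hf.exists_eq_sum_characters
  obtain ⟨e', a', χ', h'⟩ := hg.exists_eq_sum_characters
  refine isPEPoly_of_eq_sum_characters (fun p : Fin e × Fin e' => a p.1 * a' p.2)
    (fun p => χ p.1 * χ' p.2) fun n => ?_
  rw [h, h', Fintype.sum_mul_sum, Fintype.sum_prod_type]
  simp [mul_mul_mul_comm]

theorem IsPEPoly.sum {ι : Type*} (t : Finset ι) {f : ι → (Fin r → ℤ) → AlgebraicClosure K}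
    (hf : ∀ i, IsPEPoly K (f i)) : IsPEPoly K (fun n => ∑ i ∈ t, f i n) := by
  classical
  induction t using Finset.induction_on with
  | empty => simpa using isPEPoly_const 0
  | insert i t hi ih => simpa [Finset.sum_insert hi] using (hf i).add ih

theorem IsPEPoly.comp {r' : ℕ} {f : (Fin r → ℤ) → AlgebraicClosure K} (hf : IsPEPoly K f)
    (φ : (Fin r' → ℤ) →+ (Fin r → ℤ)) : IsPEPoly K (fun n => f (φ n)) := by
  obtain ⟨e, a, χ, h⟩ := hf.exists_eq_sum_characters
  exact isPEPoly_of_eq_sum_characters a (fun j => (χ j).comp φ.toMultiplicative) (by simp [h])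

/-- The integer powers of an invertible semi-simple matrix are simultaneously diagonalized with
invertible eigenvalues. -/
theorem IsSemisimpleMat.exists_map_zpow_eq {n : ℕ} {s : (Matrix (Fin n) (Fin n) K)ˣ}
    (hs : IsSemisimpleMat (s : Matrix (Fin n) (Fin n) K)) :
    ∃ (P Q : Matrix (Fin n) (Fin n) (AlgebraicClosure K)) (u : Fin n → (AlgebraicClosure K)ˣ),
      ∀ k : ℤ, ((s ^ k : (Matrix (Fin n) (Fin n) K)ˣ) : Matrix (Fin n) (Fin n) K).map
          (algebraMap K (AlgebraicClosure K)) =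
        P * Matrix.diagonal (fun i => ((u i ^ k : (AlgebraicClosure K)ˣ) : AlgebraicClosure K)) *
          Q := by
  obtain ⟨P, d, h⟩ := hs
  let φ : (Matrix (Fin n) (Fin n) K)ˣ →* (Matrix (Fin n) (Fin n) (AlgebraicClosure K))ˣ :=
    Units.map (algebraMap K (AlgebraicClosure K)).mapMatrix.toMonoidHom
  have hφ : ((P⁻¹ * φ s * P : (Matrix (Fin n) (Fin n) (AlgebraicClosure K))ˣ) :
      Matrix (Fin n) (Fin n) (AlgebraicClosure K)) = Matrix.diagonal d := h
  have hd : IsUnit d := by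
    rw [← Matrix.isUnit_diagonal, ← hφ]
    exact Units.isUnit _
  obtain ⟨v, rfl⟩ := hd
  let δ : (Fin n → AlgebraicClosure K)ˣ →* (Matrix (Fin n) (Fin n) (AlgebraicClosure K))ˣ :=
    Units.map (Matrix.diagonalRingHom (Fin n) (AlgebraicClosure K)).toMonoidHom
  have hδ : φ s = P * δ v * P⁻¹ := by
    have : P⁻¹ * φ s * P = δ v := Units.ext hφ
    rw [← this]
    group
  refine ⟨P, (P⁻¹ : (Matrix (Fin n) (Fin n) (AlgebraicClosure K))ˣ), MulEquiv.piUnits v,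
    fun k => ?_⟩
  have hk : φ (s ^ k) = P * δ (v ^ k) * P⁻¹ := by
    rw [map_zpow, hδ, conj_zpow, map_zpow]
  have hv : (fun i => (((MulEquiv.piUnits v i) ^ k : (AlgebraicClosure K)ˣ) :
      AlgebraicClosure K)) = ((v ^ k : (Fin n → AlgebraicClosure K)ˣ) :
        Fin n → AlgebraicClosure K) := by
    funext i
    rw [← Pi.pow_apply, ← map_zpow]
    rfl
  rw [hv]
  exact congrArg Units.val hk

end PEP

open PEP in
/-- If `Σ ⊆ GL_n(K)` (`K` of characteristic zero) admits a purely exponential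
parametrization and `s ∈ GL_n(K)` is semi-simple, then `Σ ⋅ ⟨s⟩ = {σ sᵏ}` also admits a
purely exponential parametrization. -/
theorem pep_mul_cyclic_semisimple {K : Type*} [Field K] [CharZero K] {n : ℕ}
    (S : Set (Matrix (Fin n) (Fin n) K)ˣ)
    (hS : ∃ r : ℕ, IsPEPSet K r
      ((fun A : (Matrix (Fin n) (Fin n) K)ˣ =>
        entries (A : Matrix (Fin n) (Fin n) K)) '' S))
    (s : (Matrix (Fin n) (Fin n) K)ˣ)
    (hs : IsSemisimpleMat ((s : Matrix (Fin n) (Fin n) K))) :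
    ∃ r : ℕ, IsPEPSet K r
      ((fun A : (Matrix (Fin n) (Fin n) K)ˣ =>
        entries (A : Matrix (Fin n) (Fin n) K)) ''
        {x | ∃ σ ∈ S, ∃ k : ℤ, x = σ * s ^ k}) := by
  obtain ⟨r, f, hf, hfS, hSf⟩ := hS
  obtain ⟨P, Q, u, hu⟩ := hs.exists_map_zpow_eq
  let φ : (Fin (r + 1) → ℤ) →+ (Fin r → ℤ) :=
    { toFun := fun m i => m i.castSucc
      map_zero' := rfl
      map_add' := fun _ _ => rfl }
  let g (k : ℤ) (i j : Fin n) : AlgebraicClosure K :=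
    ((s ^ k : (Matrix (Fin n) (Fin n) K)ˣ) : Matrix (Fin n) (Fin n) K).map
      (algebraMap K (AlgebraicClosure K)) i j
  have key (σ : (Matrix (Fin n) (Fin n) K)ˣ) (m : Fin r → ℤ) (k : ℤ)
      (h : ∀ i, algebraMap K (AlgebraicClosure K)
        (entries (σ : Matrix (Fin n) (Fin n) K) i) = f i m) (p : Fin n × Fin n) :
      algebraMap K (AlgebraicClosure K)
        (entries ((σ * s ^ k : (Matrix (Fin n) (Fin n) K)ˣ) : Matrix (Fin n) (Fin n) K) p) =
        ∑ q, f (p.1, q) m * g k q p.2 := by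
    simp only [← h, entries, g, Units.val_mul, Matrix.mul_apply, map_sum, map_mul,
      Matrix.map_apply]
  refine ⟨r + 1, fun p m => ∑ q, f (p.1, q) (φ m) * g (m (Fin.last r)) q p.2, ?_, ?_, ?_⟩
  · intro p
    refine IsPEPoly.sum _ fun q => ((hf _).comp φ).mul ?_
    simp only [g, hu, Matrix.mul_apply (N := Q), Matrix.mul_diagonal]
    exact IsPEPoly.sum _ fun t => ((isPEPoly_const _).mul
      (isPEPoly_zpow (u t) (Pi.evalAddMonoidHom (fun _ => ℤ) (Fin.last r)))).mul
        (isPEPoly_const _)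
  · intro m
    obtain ⟨_, ⟨σ, hσ, rfl⟩, h⟩ := hfS (φ m)
    exact ⟨_, ⟨_, ⟨σ, hσ, m (Fin.last r), rfl⟩, rfl⟩, key σ _ _ h⟩
  · rintro _ ⟨_, ⟨σ, hσ, k, rfl⟩, rfl⟩
    obtain ⟨m, h⟩ := hSf _ ⟨σ, hσ, rfl⟩
    refine ⟨Fin.snoc (α := fun _ => ℤ) m k, fun p => ?_⟩
    have hm : φ (Fin.snoc (α := fun _ => ℤ) m k) = m := by
      funext i
      exact Fin.snoc_castSucc (α := fun _ => ℤ) k m i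
    simp only [hm, Fin.snoc_last]
    exact key σ m k h p
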